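/- Let d ≥ 1, let E be a set of matrix positions (pairs (i,j) with 1 ≤ i,j ≤ d), let e ∈ E, and let Σ be a symmetric positive definite real d×d matrix. Suppose there exist real d×d matrices A⁺, D⁺ with D⁺ symmetric positive definite, A⁺Σ + Σ(A⁺)ᵀ = −D⁺, supp(A⁺) = E and the entry of A⁺ at position e strictly positive; and suppose there exist A⁰, D⁰ with D⁰ symmetric positive definite, A⁰Σ + Σ(A⁰)ᵀ = −D⁰, supp(A⁰) ⊆ E, and the entry of A⁰ at position e equal to 0. Then there exist real d×d matrices A⁻, D⁻ such that D⁻ is symmetric positive definite, A⁻Σ + Σ(A⁻)ᵀ = −D⁻, supp(A⁻) = E, and the entry of A⁻ at position e is strictly negative. -/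

import Mathlib

open Matrix

open Filter Topology in
/-- Positive definiteness is stable under small symmetric perturbations along a line. -/
theorem Matrix.PosDef.eventually_sub_smul {n : Type*} [Fintype n] {M N : Matrix n n ℝ}
    (hM : M.PosDef) (hN : N.IsHermitian) :
    ∀ᶠ t : ℝ in 𝓝 0, (M - t • N).PosDef := by
  have hpos : ∀ᶠ t : ℝ in 𝓝 0, ∀ x ∈ Metric.sphere (0 : n → ℝ) 1,
      0 < x ⬝ᵥ ((M - t • N) *ᵥ x) := by
    refine (isCompact_sphere (0 : n → ℝ) 1).eventually_forall_of_forall_eventually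
      fun x hx => ?_
    have hx0 : x ≠ 0 := ne_zero_of_mem_unit_sphere ⟨x, hx⟩
    have hcont : Continuous fun p : ℝ × (n → ℝ) => p.2 ⬝ᵥ ((M - p.1 • N) *ᵥ p.2) := by
      fun_prop
    refine hcont.continuousAt.eventually (lt_mem_nhds ?_)
    simpa using hM.dotProduct_mulVec_pos hx0
  filter_upwards [hpos] with t ht
  refine .of_dotProduct_mulVec_pos (hM.isHermitian.sub ?_) fun x hx => ?_
  · rw [IsHermitian, conjTranspose_smul, hN.eq, star_trivial]
  · have hnorm : 0 < ‖x‖ := norm_pos_iff.mpr hx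
    have h := ht (‖x‖⁻¹ • x) (by simp [norm_smul, hnorm.ne'])
    rw [mulVec_smul, smul_dotProduct, dotProduct_smul, smul_eq_mul, smul_eq_mul] at h
    have hinv : 0 < ‖x‖⁻¹ := inv_pos.mpr hnorm
    simpa using pos_of_mul_pos_right (pos_of_mul_pos_right h hinv.le) hinv.le

open Filter Topology in
theorem eventually_sub_mul_ne_zero (a : ℝ) {b : ℝ} (hb : b ≠ 0) :
    ∀ᶠ t : ℝ in 𝓝[>] 0, a - t * b ≠ 0 := by
  have h : ∀ᶠ t : ℝ in 𝓝[≠] 0, a - t * b ≠ 0 := by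
    by_cases ha : a = 0
    · filter_upwards [self_mem_nhdsWithin] with t ht
      simpa [ha, hb] using ht
    · have hcont : Continuous fun t : ℝ => a - t * b := by fun_prop
      exact (hcont.continuousAt.eventually_ne (by simpa using ha)).filter_mono
        nhdsWithin_le_nhds
  exact h.filter_mono (nhdsWithin_mono 0 fun _ ht => ne_of_gt ht)

theorem stmt_5 (d : ℕ) (hd : 1 ≤ d) (E : Set (Fin d × Fin d)) (e : Fin d × Fin d)
    (he : e ∈ E) (S : Matrix (Fin d) (Fin d) ℝ) (hS : S.PosDef)
    (hplus : ∃ A D : Matrix (Fin d) (Fin d) ℝ, D.PosDef ∧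
      A * S + S * Aᵀ = -D ∧ (∀ i j, A i j ≠ 0 ↔ (i, j) ∈ E) ∧ 0 < A e.1 e.2)
    (hzero : ∃ A D : Matrix (Fin d) (Fin d) ℝ, D.PosDef ∧
      A * S + S * Aᵀ = -D ∧ (∀ i j, (i, j) ∉ E → A i j = 0) ∧ A e.1 e.2 = 0) :
    ∃ A D : Matrix (Fin d) (Fin d) ℝ, D.PosDef ∧
      A * S + S * Aᵀ = -D ∧ (∀ i j, A i j ≠ 0 ↔ (i, j) ∈ E) ∧ A e.1 e.2 < 0 := by
  obtain ⟨A, D, hD, hAD, hA, hAe⟩ := hplus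
  obtain ⟨B, F, hF, hBF, hB, hBe⟩ := hzero
  have hsupp : ∀ᶠ t : ℝ in nhdsWithin 0 (Set.Ioi 0), ∀ i j, (i, j) ∈ E →
      B i j - t * A i j ≠ 0 := by
    simp only [Filter.eventually_all]
    exact fun i j hij => eventually_sub_mul_ne_zero _ ((hA i j).mpr hij)
  obtain ⟨t, ht, htF, ht0⟩ := (hsupp.and (((hF.eventually_sub_smul hD.isHermitian).filter_mono
    nhdsWithin_le_nhds).and self_mem_nhdsWithin)).exists
  refine ⟨B - t • A, F - t • D, htF, ?_, fun i j => ⟨fun h => ?_, ht i j⟩, ?_⟩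
  · calc (B - t • A) * S + S * (B - t • A)ᵀ
        = (B * S + S * Bᵀ) - t • (A * S + S * Aᵀ) := by
          simp only [transpose_sub, transpose_smul, sub_mul, mul_sub, smul_mul, Matrix.mul_smul,
            smul_add]
          abel
      _ = -(F - t • D) := by
          rw [hBF, hAD, smul_neg]
          abel
  · by_contra hij
    have hAij : A i j = 0 := not_not.mp fun h => hij ((hA i j).mp h)
    exact h (by simp [hB i j hij, hAij])
  · simpa [hBe] using mul_pos ht0 hAe
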